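/- arXiv:2309.10648 — 4 statements merged into one kernel-verified Lean document; each statement's English description precedes it below -/
import Mathlib

section
/- Let p, q ≥ 2 be integers and G_{p,q} = ⟨x, y | x^p = y^q⟩ the torus knot group. The centre of G_{p,q} equals the cyclic subgroup generated by x^p (equivalently by y^q), and x^p has infinite order; in particular the centre of G_{p,q} is infinite cyclic. -/
/-- The torus knot group `⟨x, y | x^p = y^q⟩`, as the presented group obtained as the
quotient of the free group on two generators by the normal closure of `a^p * b^(-q)`. -/
def TKG (p q : ℕ) : Type :=
  PresentedGroup ({FreeGroup.of true ^ p * (FreeGroup.of false ^ q)⁻¹} : Set (FreeGroup Bool))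

instance TKG.instGroup (p q : ℕ) : Group (TKG p q) := by
  delta TKG; infer_instance

/-- The generator `x` of the torus knot group. -/
def TKx (p q : ℕ) : TKG p q := PresentedGroup.of true

/-- The generator `y` of the torus knot group. -/
def TKy (p q : ℕ) : TKG p q := PresentedGroup.of false

theorem TKG_relation (p q : ℕ) : TKx p q ^ p = TKy p q ^ q := by
  have h := PresentedGroup.one_of_mem
    (rels := ({FreeGroup.of true ^ p * (FreeGroup.of false ^ q)⁻¹} : Set (FreeGroup Bool)))
    (Set.mem_singleton _)
  rw [map_mul, map_inv, map_pow, map_pow] at h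
  exact mul_inv_eq_one.mp h

theorem TKG_exists_lift (p q : ℕ) {H : Type*} [Group H] (a b : H) (h : a ^ p = b ^ q) :
    ∃ f : TKG p q →* H, f (TKx p q) = a ∧ f (TKy p q) = b := by
  have hr : ∀ r ∈ ({FreeGroup.of true ^ p * (FreeGroup.of false ^ q)⁻¹} : Set (FreeGroup Bool)),
      FreeGroup.lift (fun c : Bool => cond c a b) r = 1 := by
    intro r hr
    rw [Set.mem_singleton_iff.mp hr]
    simp [h]
  exact ⟨PresentedGroup.toGroup hr, PresentedGroup.toGroup.of hr, PresentedGroup.toGroup.of hr⟩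

theorem TKG_hom_ext (p q : ℕ) {H : Type*} [Group H] (f g : TKG p q →* H)
    (hx : f (TKx p q) = g (TKx p q)) (hy : f (TKy p q) = g (TKy p q)) : f = g := by
  refine PresentedGroup.ext (φ := f) (ψ := g) ?_
  intro c
  cases c
  · exact hy
  · exact hx

theorem TKG_central (p q : ℕ) : TKx p q ^ p ∈ Subgroup.center (TKG p q) := by
  rw [Subgroup.mem_center_iff]
  intro g
  have h : (MulAut.conj (TKx p q ^ p)).toMonoidHom = MonoidHom.id (TKG p q) := by
    apply TKG_hom_ext
    · simp only [MulEquiv.toMonoidHom_eq_coe, MonoidHom.coe_coe, MulAut.conj_apply,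
        MonoidHom.id_apply]
      rw [mul_inv_eq_iff_eq_mul]
      exact ((Commute.refl _).pow_left p)
    · rw [TKG_relation]
      simp only [MulEquiv.toMonoidHom_eq_coe, MonoidHom.coe_coe, MulAut.conj_apply,
        MonoidHom.id_apply]
      rw [mul_inv_eq_iff_eq_mul]
      exact ((Commute.refl _).pow_left q)
  have h2 := DFunLike.congr_fun h g
  simp only [MulEquiv.toMonoidHom_eq_coe, MonoidHom.coe_coe, MulAut.conj_apply,
        MonoidHom.id_apply] at h2
  exact (mul_inv_eq_iff_eq_mul.mp h2).symm

open Monoid in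
/-- The centre of a free product of nontrivial groups is trivial. -/
theorem CoprodI_center_trivial {ι : Type*} [Nontrivial ι] (M : ι → Type*) [∀ i, Group (M i)]
    [∀ i, Nontrivial (M i)] (z : CoprodI M) (hz : ∀ g, g * z = z * g) : z = 1 := by
  classical
  by_contra hne
  obtain ⟨w, rfl⟩ := (CoprodI.Word.equiv (M := M)).symm.surjective z
  have hw : w ≠ CoprodI.Word.empty := by
    rintro rfl
    exact hne CoprodI.Word.prod_empty
  obtain ⟨i, j, w, rfl⟩ := CoprodI.NeWord.of_word w hw
  obtain ⟨k, hk⟩ := exists_ne j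
  obtain ⟨a, ha⟩ := exists_ne (1 : M k)
  let s := CoprodI.NeWord.singleton a ha
  let u := (w.append hk.symm s).append hk w.inv
  have h1 : u.prod = s.prod := by
    have := hz s.prod
    change s.prod * w.prod = w.prod * s.prod at this
    simp only [u, CoprodI.NeWord.append_prod, CoprodI.NeWord.inv_prod]
    rw [← this, mul_inv_cancel_right]
  have h2 : u.toWord = s.toWord := (CoprodI.Word.equiv (M := M)).symm.injective h1
  have h3 : u.toList = s.toList := congrArg CoprodI.Word.toList h2
  have h4 := congrArg List.length h3
  have h5 := List.length_pos_of_ne_nil w.toList_ne_nil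
  have h6 := List.length_pos_of_ne_nil w.inv.toList_ne_nil
  simp only [u, s, CoprodI.NeWord.toList, List.length_append, List.length_singleton] at h4
  omega

theorem TKG_not_finOrder (p q : ℕ) (hp : 2 ≤ p) (hq : 2 ≤ q) :
    ¬ IsOfFinOrder (TKx p q ^ p) := by
  intro h
  obtain ⟨f, hx, -⟩ := TKG_exists_lift p q (Multiplicative.ofAdd (q : ℤ))
    (Multiplicative.ofAdd (p : ℤ)) (by
      rw [← ofAdd_nsmul, ← ofAdd_nsmul]; simp [mul_comm])
  have h2 := f.isOfFinOrder h
  rw [map_pow, hx, isOfFinOrder_iff_pow_eq_one] at h2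
  obtain ⟨n, hn, h3⟩ := h2
  rw [← ofAdd_nsmul, ← ofAdd_nsmul, ofAdd_eq_one] at h3
  simp at h3
  omega

open Monoid in
theorem TKG_center_le (p q : ℕ) (hp : 2 ≤ p) (hq : 2 ≤ q) :
    Subgroup.center (TKG p q) ≤ Subgroup.zpowers (TKx p q ^ p) := by
  intro z hz
  rw [Subgroup.mem_center_iff] at hz
  have hle : Subgroup.zpowers (TKx p q ^ p) ≤ Subgroup.center (TKG p q) := by
    rw [Subgroup.zpowers_le]; exact TKG_central p q
  have hN : (Subgroup.zpowers (TKx p q ^ p)).Normal := by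
    constructor
    intro n hn g
    rw [Subgroup.mem_center_iff.mp (hle hn) g, mul_inv_cancel_right]
    exact hn
  let m : Bool → ℕ := fun b => cond b p q
  have : ∀ b, Nontrivial (Multiplicative (ZMod (m b))) := by
    intro b
    have : Fact (1 < m b) := ⟨by cases b <;> simp [m] <;> omega⟩
    infer_instance
  let M : Bool → Type := fun b => Multiplicative (ZMod (m b))
  let t : ∀ b, M b := fun b => Multiplicative.ofAdd (1 : ZMod (m b))
  have ht : ∀ b, t b ^ m b = 1 := by
    intro b
    change Multiplicative.ofAdd (1 : ZMod (m b)) ^ m b = 1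
    rw [← ofAdd_nsmul]; simp
  obtain ⟨f, fx, fy⟩ := TKG_exists_lift p q (CoprodI.of (t true)) (CoprodI.of (t false)) (by
    rw [← map_pow CoprodI.of (t true) p, ← map_pow CoprodI.of (t false) q,
      show t true ^ p = 1 from ht true, show t false ^ q = 1 from ht false,
      map_one, map_one])
  -- homs out of the cyclic factors
  have key : ∀ (n : ℕ) {Q : Type} [Group Q] (c : Q), c ^ n = 1 →
      ∃ φ : Multiplicative (ZMod n) →* Q, φ (Multiplicative.ofAdd 1) = c := by
    intro n Q _ c hc
    refine ⟨AddMonoidHom.toMultiplicativeLeft (ZMod.lift n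
      ⟨zmultiplesHom (Additive Q) (Additive.ofMul c), ?_⟩), ?_⟩
    · simp [← ofMul_pow, hc]
    · have := ZMod.lift_coe n (⟨zmultiplesHom (Additive Q) (Additive.ofMul c), by
        simp [← ofMul_pow, hc]⟩ : {f : ℤ →+ Additive Q // f n = 0}) 1
      simp only [Int.cast_one] at this
      simp [this]
  let π := QuotientGroup.mk' (Subgroup.zpowers (TKx p q ^ p))
  have hπ : π (TKx p q ^ p) = 1 :=
    (QuotientGroup.eq_one_iff _).mpr (Subgroup.mem_zpowers _)
  obtain ⟨φ₁, h₁⟩ := key p (π (TKx p q)) (by rw [← map_pow, hπ])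
  obtain ⟨φ₂, h₂⟩ := key q (π (TKy p q)) (by rw [← map_pow, ← TKG_relation, hπ])
  let φ : ∀ b, M b →* (TKG p q ⧸ Subgroup.zpowers (TKx p q ^ p)) := fun b =>
    match b with
    | true => φ₁
    | false => φ₂
  have hcomp : (CoprodI.lift φ).comp f = π := by
    apply TKG_hom_ext
    · rw [MonoidHom.comp_apply, fx, CoprodI.lift_of]; exact h₁
    · rw [MonoidHom.comp_apply, fy, CoprodI.lift_of]; exact h₂
  -- `f` is surjective
  have hsurj : Function.Surjective f := by
    have hof : ∀ b, CoprodI.of (t b) ∈ f.range := by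
      intro b
      cases b
      · exact ⟨_, fy⟩
      · exact ⟨_, fx⟩
    intro g
    change g ∈ f.range
    induction g using CoprodI.induction_on with
    | one => exact one_mem _
    | mul a b ha hb => exact mul_mem ha hb
    | of b a =>
      have : a = t b ^ (ZMod.cast (Multiplicative.toAdd a : ZMod (m b)) : ℤ) := by
        change a = Multiplicative.ofAdd (1 : ZMod (m b)) ^ _
        rw [← ofAdd_zsmul]
        simp
      rw [this, map_zpow]
      exact zpow_mem (hof b) _
  have hfz : f z = 1 := by
    apply CoprodI_center_trivial M
    intro g
    obtain ⟨g, rfl⟩ := hsurj g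
    rw [← map_mul, ← map_mul, hz]
  have h := DFunLike.congr_fun hcomp z
  rw [MonoidHom.comp_apply, hfz, map_one] at h
  exact (QuotientGroup.eq_one_iff z).mp h.symm

/-- The centre of the torus knot group `G_{p,q}` is the cyclic subgroup generated by
`x^p` (equivalently `y^q`), and `x^p` has infinite order: the centre is infinite cyclic. -/
theorem TKG_center (p q : ℕ) (hp : 2 ≤ p) (hq : 2 ≤ q) :
    Subgroup.center (TKG p q) = Subgroup.zpowers (TKx p q ^ p) ∧
    TKx p q ^ p = TKy p q ^ q ∧
    ¬ IsOfFinOrder (TKx p q ^ p) := by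
  refine ⟨le_antisymm (TKG_center_le p q hp hq) ?_, TKG_relation p q, TKG_not_finOrder p q hp hq⟩
  rw [Subgroup.zpowers_le]
  exact TKG_central p q
end

section
/- Let p, q ≥ 2 be integers and G_{p,q} = ⟨x, y | x^p = y^q⟩. If g ∈ G_{p,q} is not central, then the maximal cyclic subgroup containing g is well defined: there exists a cyclic subgroup M of G_{p,q} with g ∈ M such that every cyclic subgroup of G_{p,q} containing g is contained in M. -/
namespace TKaux
open Monoid

section FM
variable {α : Type*}

theorem prefix_of_comm (g r : FreeMonoid α) (hg : g ≠ 1) (h : r * g = g * r) (N : ℕ)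
    (hN : r.length ≤ N) : r.toList <+: (g ^ N).toList := by
  have hc : r * g ^ N = g ^ N * r := (Commute.pow_right (show Commute r g from h) N)
  have h1 : r.toList <+: (r * g ^ N).toList := by
    rw [FreeMonoid.toList_mul]; exact List.prefix_append _ _
  have h2 : (g ^ N).toList <+: (r * g ^ N).toList := by
    rw [hc, FreeMonoid.toList_mul]; exact List.prefix_append _ _
  refine List.prefix_of_prefix_length_le h1 h2 ?_
  have hl : ∀ n : ℕ, n ≤ (g ^ n).length := by
    intro n
    have : 1 ≤ g.length := by
      rcases Nat.eq_zero_or_pos g.length with h | h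
      · exact absurd (FreeMonoid.length_eq_zero.1 h) hg
      · exact h
    induction n with
    | zero => simp
    | succ k ih => rw [pow_succ, FreeMonoid.length_mul]; omega
  exact hN.trans (hl N)

theorem exists_root (g : FreeMonoid α) (hg : g ≠ 1) :
    ∃ w : FreeMonoid α, ∀ r, r * g = g * r → ∃ n : ℕ, r = w ^ n := by
  classical
  have hex : ∃ n : ℕ, ∃ w : FreeMonoid α, w ≠ 1 ∧ w * g = g * w ∧ w.length = n :=
    ⟨_, g, hg, rfl, rfl⟩
  obtain ⟨w, hw1, hwg, hwl⟩ := Nat.find_spec hex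
  have hmin : ∀ r : FreeMonoid α, r ≠ 1 → r * g = g * r → w.length ≤ r.length := by
    intro r h1 h2
    rw [hwl]
    exact Nat.find_min' hex ⟨r, h1, h2, rfl⟩
  refine ⟨w, ?_⟩
  have main : ∀ n : ℕ, ∀ r : FreeMonoid α, r.length = n → r * g = g * r → ∃ n : ℕ, r = w ^ n := by
    intro n
    induction n using Nat.strong_induction_on with
    | _ n ih =>
      intro r hr hc
      by_cases h1 : r = 1
      · exact ⟨0, by simpa using h1⟩
      have hle := hmin r h1 hc
      have hp : w.toList <+: r.toList :=
        List.prefix_of_prefix_length_le (prefix_of_comm g w hg hwg r.length hle)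
          (prefix_of_comm g r hg hc r.length le_rfl) hle
      obtain ⟨t, ht⟩ := hp
      have ht' : r = w * FreeMonoid.ofList t := by
        apply FreeMonoid.toList.injective
        rw [FreeMonoid.toList_mul, FreeMonoid.toList_ofList, ht]
      have hwpos : 0 < w.length := by
        rcases Nat.eq_zero_or_pos w.length with h | h
        · exact absurd (FreeMonoid.length_eq_zero.1 h) hw1
        · exact h
      have hlen : r.length = w.length + (FreeMonoid.ofList t).length := by
        rw [ht', FreeMonoid.length_mul]
      obtain ⟨k, hk⟩ := ih (FreeMonoid.ofList t).length (by omega) (FreeMonoid.ofList t) rfl (by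
        rw [ht'] at hc
        apply mul_left_cancel (a := w)
        rw [← mul_assoc, hc, ← mul_assoc, ← mul_assoc, hwg])
      exact ⟨k + 1, by rw [ht', hk, pow_succ']⟩
  exact fun r => main _ r rfl
end FM

section CP
variable {ι : Type*} {G : ι → Type*} [∀ i, Group (G i)]

def Red (l : List (Σ i, G i)) : Prop :=
  (∀ x ∈ l, x.2 ≠ 1) ∧ l.IsChain (fun a b => a.1 ≠ b.1)

def pr (l : List (Σ i, G i)) : CoprodI G := (l.map (fun x => CoprodI.of x.2)).prod

@[simp] theorem pr_nil : pr ([] : List (Σ i, G i)) = 1 := rfl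
@[simp] theorem pr_cons (a : Σ i, G i) (l) : pr (a :: l) = CoprodI.of a.2 * pr l := by simp [pr]
@[simp] theorem pr_append (l m : List (Σ i, G i)) : pr (l ++ m) = pr l * pr m := by simp [pr]

theorem red_inj {l m : List (Σ i, G i)} (hl : Red l) (hm : Red m) (h : pr l = pr m) : l = m := by
  classical
  have := (CoprodI.Word.equiv (M := G)).symm.injective
    (a₁ := ⟨l, fun x hx => hl.1 x hx, hl.2⟩) (a₂ := ⟨m, fun x hx => hm.1 x hx, hm.2⟩) h
  exact congrArg CoprodI.Word.toList this

theorem exists_red (x : CoprodI G) : ∃ l, Red l ∧ pr l = x := by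
  classical
  let w := CoprodI.Word.equiv x
  refine ⟨w.toList, ⟨fun x hx => w.ne_one x hx, w.chain_ne⟩, ?_⟩
  exact (CoprodI.Word.equiv (M := G)).symm_apply_apply x

theorem Red.of_append_left {l m : List (Σ i, G i)} (h : Red (l ++ m)) : Red l :=
  ⟨fun x hx => h.1 x (by simp [hx]), (List.isChain_append.1 h.2).1⟩
theorem Red.of_append_right {l m : List (Σ i, G i)} (h : Red (l ++ m)) : Red m :=
  ⟨fun x hx => h.1 x (by simp [hx]), (List.isChain_append.1 h.2).2.1⟩

theorem Red.append {l m : List (Σ i, G i)} (hl : Red l) (hm : Red m)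
    (h : ∀ x ∈ l.getLast?, ∀ y ∈ m.head?, x.1 ≠ y.1) : Red (l ++ m) := by
  refine ⟨fun x hx => ?_, List.isChain_append.2 ⟨hl.2, hm.2, h⟩⟩
  rcases List.mem_append.1 hx with h | h
  · exact hl.1 x h
  · exact hm.1 x h

def linv (l : List (Σ i, G i)) : List (Σ i, G i) :=
  (l.map (fun x => (⟨x.1, x.2⁻¹⟩ : Σ i, G i))).reverse

theorem pr_linv (l : List (Σ i, G i)) : pr (linv l) = (pr l)⁻¹ := by
  induction l with
  | nil => simp [linv]
  | cons a l ih =>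
    have : linv (a :: l) = linv l ++ [⟨a.1, a.2⁻¹⟩] := by simp [linv]
    rw [this, pr_append, ih]; simp

theorem Red.linv {l : List (Σ i, G i)} (h : Red l) : Red (linv l) := by
  refine ⟨?_, ?_⟩
  · intro x hx
    simp only [TKaux.linv, List.mem_reverse, List.mem_map] at hx
    obtain ⟨y, hy, rfl⟩ := hx
    simpa using h.1 y hy
  · unfold TKaux.linv
    rw [List.isChain_reverse, List.isChain_map]
    exact h.2.imp (fun a b hab => hab.symm)

/-- The word of `x` has length more than `m` and ends in index `j`. -/
def Q (j : ι) (m : ℕ) (x : CoprodI G) : Prop :=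
  ∃ l, ∃ a : G j, Red (l ++ [⟨j, a⟩]) ∧ pr (l ++ [⟨j, a⟩]) = x ∧ m ≤ l.length

theorem Q_letter {j : ι} {m : ℕ} {x : CoprodI G} (h : Q j (m + 1) x) {i : ι} (b : G i) :
    Q j m (CoprodI.of b * x) := by
  classical
  obtain ⟨l, a, hr, rfl, hm⟩ := h
  by_cases hb : b = 1
  · subst hb
    exact ⟨l, a, hr, by simp, by omega⟩
  match l, hm with
  | ⟨k, c⟩ :: t, hm =>
    simp only [List.length_cons] at hm
    by_cases hk : i = k
    · subst hk
      by_cases hbc : b * c = 1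
      · refine ⟨t, a, Red.of_append_right (l := [⟨i, c⟩]) hr, ?_, by omega⟩
        simp only [List.cons_append, pr_cons, ← mul_assoc, ← map_mul, hbc]
        simp
      · refine ⟨⟨i, b * c⟩ :: t, a, ⟨?_, ?_⟩, by simp [mul_assoc], by simp; omega⟩
        · intro x hx
          simp only [List.cons_append, List.mem_cons] at hx
          rcases hx with rfl | hx
          · exact hbc
          · exact hr.1 x (by simp only [List.cons_append, List.mem_cons]; exact Or.inr hx)
        · have := hr.2
          simp only [List.cons_append, List.isChain_cons] at this ⊢
          exact this
    · refine ⟨⟨i, b⟩ :: ⟨k, c⟩ :: t, a, ?_, by simp, by simp; omega⟩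
      refine Red.append (l := [⟨i, b⟩]) (m := ⟨k, c⟩ :: t ++ [⟨j, a⟩]) ⟨by simpa using hb, by simp⟩ hr ?_
      simpa using hk

theorem Q_mul {j : ι} (l : List (Σ i, G i)) : ∀ {m : ℕ} {x : CoprodI G}, Q j (m + l.length) x →
    Q j m (pr l * x) := by
  induction l with
  | nil => intro m x h; simpa using h
  | cons a l ih =>
    intro m x h
    rw [pr_cons, mul_assoc]
    apply Q_letter
    apply ih
    convert h using 1
    simp; omega

/-- cyclically reduced list with first index `i` and last index `j` -/
def CR (i j : ι) (l : List (Σ i, G i)) : Prop :=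
  i ≠ j ∧ Red l ∧ (∃ a, l.head? = some ⟨i, a⟩) ∧ (∃ a, l.getLast? = some ⟨j, a⟩)

theorem CR.linv {i j : ι} {l : List (Σ i, G i)} (h : CR i j l) : CR j i (linv l) := by
  obtain ⟨h1, h2, ⟨a, ha⟩, ⟨b, hb⟩⟩ := h
  refine ⟨h1.symm, h2.linv, ⟨b⁻¹, ?_⟩, ⟨a⁻¹, ?_⟩⟩
  · simp [TKaux.linv, hb]
  · simp [TKaux.linv, ha]

theorem CR.pow {i j : ι} {l : List (Σ i, G i)} (h : CR i j l) (n : ℕ) :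
    ∃ m, CR i j m ∧ pr m = pr l ^ (n + 1) ∧ n < m.length := by
  induction n with
  | zero =>
    refine ⟨l, h, by simp, ?_⟩
    obtain ⟨a, ha⟩ := h.2.2.1
    rcases l with _ | ⟨x, t⟩
    · simp at ha
    · simp
  | succ k ih =>
    obtain ⟨m, hm, hp, hl⟩ := ih
    obtain ⟨a, ha⟩ := h.2.2.1
    obtain ⟨b, hb⟩ := h.2.2.2
    obtain ⟨a', ha'⟩ := hm.2.2.1
    obtain ⟨b', hb'⟩ := hm.2.2.2
    refine ⟨m ++ l, ⟨h.1, ?_, ⟨a', by simp [ha']⟩, ⟨b, by simp [hb]⟩⟩, by simp [hp, pow_succ], ?_⟩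
    · refine hm.2.1.append h.2.1 ?_
      simp only [hb', ha, Option.mem_some_iff]
      rintro _ rfl _ rfl
      exact h.1.symm
    · rcases l with _ | ⟨x, t⟩
      · simp at ha
      · simp; omega

theorem CR.Q {i j : ι} {l : List (Σ i, G i)} (h : CR i j l) (x : CoprodI G) :
    ∃ N : ℕ, ∀ n, N ≤ n → TKaux.Q j 0 (x * pr l ^ n) := by
  obtain ⟨s, hs, rfl⟩ := exists_red x
  refine ⟨s.length + 1, fun n hn => ?_⟩
  obtain ⟨n, rfl⟩ : ∃ k, n = k + 1 := ⟨n - 1, by omega⟩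
  apply Q_mul
  obtain ⟨m, hm, hp, hl⟩ := h.pow n
  obtain ⟨b, hb⟩ := hm.2.2.2
  obtain ⟨t, rfl⟩ := List.getLast?_eq_some_iff.1 hb
  refine ⟨t, b, hm.2.1, hp, ?_⟩
  simp at hl
  omega

theorem CR.infinite {i j : ι} {l : List (Σ i, G i)} (h : CR i j l) (n : ℕ) (hn : n ≠ 0) :
    pr l ^ n ≠ 1 := by
  obtain ⟨n, rfl⟩ : ∃ k, n = k + 1 := ⟨n - 1, by omega⟩
  obtain ⟨m, hm, hp, hl⟩ := h.pow n
  intro h1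
  have : m = [] := red_inj hm.2.1 ⟨by simp, by simp⟩ (by rw [hp, h1]; rfl)
  subst this
  simp at hl

theorem CR.centralizer {i j : ι} {l : List (Σ i, G i)} (h : CR i j l) :
    ∃ w : CoprodI G, (∀ n : ℤ, n ≠ 0 → w ^ n ≠ 1) ∧
      ∀ z, Commute z (pr l) → z ∈ Subgroup.zpowers w := by
  let P : FreeMonoid (Σ i, G i) →* CoprodI G := FreeMonoid.lift (fun x => CoprodI.of x.2)
  have hP : ∀ s, P (FreeMonoid.ofList s) = pr s := by
    intro s; simp [P, FreeMonoid.lift_apply, pr]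
  have hne : FreeMonoid.ofList l ≠ 1 := by
    intro h1
    have h1 : l = [] := h1
    obtain ⟨a, ha⟩ := h.2.2.1
    simp [h1] at ha
  obtain ⟨w, hw⟩ := exists_root (FreeMonoid.ofList l) hne
  obtain ⟨k, hk⟩ := hw _ rfl
  have hlk : pr l = P w ^ k := by rw [← hP, hk, map_pow]
  refine ⟨P w, ?_, ?_⟩
  · intro n hn h1
    have : pr l ^ n.natAbs = 1 := by
      rw [hlk, ← pow_mul, mul_comm, pow_mul]
      have : P w ^ n.natAbs = 1 := by
        rcases Int.natAbs_eq n with e | e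
        · rw [e] at h1; simpa using h1
        · rw [e] at h1; simpa using h1
      rw [this, one_pow]
    exact h.infinite _ (by omega) this
  · intro z hz
    obtain ⟨N1, hN1⟩ := h.Q z
    obtain ⟨N2, hN2⟩ := h.linv.Q z⁻¹
    obtain ⟨t, a, ht, htp, -⟩ := hN1 (max N1 N2) (le_max_left _ _)
    obtain ⟨t', a', ht', htp', -⟩ := hN2 (max N1 N2) (le_max_right _ _)
    set n := max N1 N2
    set s := t ++ [⟨j, a⟩] with hs
    have hss : s = TKaux.linv (t' ++ [⟨i, a'⟩]) := by
      apply red_inj ht ht'.linv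
      rw [pr_linv, htp', htp, pr_linv, mul_inv_rev, inv_inv, inv_pow, inv_inv]
      exact hz.pow_right n
    have hhead : s.head? = some ⟨i, a'⁻¹⟩ := by rw [hss]; simp [TKaux.linv]
    have hlast : s.getLast? = some ⟨j, a⟩ := by simp [hs]
    obtain ⟨b, hb⟩ := h.2.2.1
    obtain ⟨c, hc⟩ := h.2.2.2
    have e : s ++ l = l ++ s := by
      apply red_inj
      · apply ht.append h.2.1
        rw [hlast, hb]
        simp only [Option.mem_some_iff]
        rintro _ rfl _ rfl
        exact h.1.symm
      · apply h.2.1.append ht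
        rw [hhead, hc]
        simp only [Option.mem_some_iff]
        rintro _ rfl _ rfl
        exact h.1.symm
      · rw [pr_append s l, pr_append l s, htp]
        exact (hz.mul_left ((Commute.refl _).pow_left n))
    obtain ⟨r, hr⟩ := hw (FreeMonoid.ofList s) e
    have h3 : z * pr l ^ n = P w ^ r := by rw [← htp, ← hP, hr, map_pow]
    have h4 : z = P w ^ r * (pr l ^ n)⁻¹ := by rw [← h3]; group
    rw [h4, hlk]
    exact Subgroup.mul_mem _ (Subgroup.pow_mem _ (Subgroup.mem_zpowers _) _)
      (Subgroup.inv_mem _ (Subgroup.pow_mem _ (Subgroup.pow_mem _ (Subgroup.mem_zpowers _) _) _))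

theorem letter_centralizer {i : ι} (a : G i) (ha : a ≠ 1) (z : CoprodI G)
    (hz : Commute z (CoprodI.of a)) : ∃ b : G i, z = CoprodI.of b := by
  classical
  have key : ∀ l : List (Σ i, G i), Red l → (∀ y ∈ l.head?, i ≠ y.1) → ∀ a' : G i, a' ≠ 1 →
      (pr l)⁻¹ * CoprodI.of a' * pr l = CoprodI.of a → l = [] := by
    intro l hl hh a' ha' hc
    have hra : Red [(⟨i, a⟩ : Σ i, G i)] := ⟨by simpa using ha, by simp⟩
    have hra' : Red [(⟨i, a'⟩ : Σ i, G i)] := ⟨by simpa using ha', by simp⟩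
    have h1 : Red ([⟨i, a'⟩] ++ l) := by
      apply hra'.append hl
      simpa using hh
    have h2 : Red (linv l ++ ([⟨i, a'⟩] ++ l)) := by
      apply hl.linv.append h1
      rcases l with _ | ⟨x, t⟩
      · simp [linv]
      · simp only [linv, List.map_cons, List.reverse_cons, List.getLast?_append]
        simp at hh
        simpa using fun h => hh h.symm
    have h3 := red_inj h2 hra (by
      rw [pr_append, pr_append, pr_linv, ← mul_assoc]
      simpa using hc)
    have h4 := congrArg List.length h3
    simp [linv] at h4
    exact List.eq_nil_of_length_eq_zero (by omega)
  obtain ⟨l, hl, rfl⟩ := exists_red z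
  have hz' : (pr l)⁻¹ * CoprodI.of a * pr l = CoprodI.of a := by
    rw [mul_assoc, ← hz.eq]; group
  rcases l with _ | ⟨⟨k, c⟩, t⟩
  · exact ⟨1, by simp⟩
  by_cases hk : i = k
  · subst hk
    have ht : t = [] := by
      apply key t (Red.of_append_right (l := [⟨i, c⟩]) hl) ?_ (c⁻¹ * a * c)
      · intro h1
        apply ha
        have : a = c * (c⁻¹ * a * c) * c⁻¹ := by group
        rw [this, h1]; group
      · rw [← hz']
        simp [mul_assoc]
      · have := hl.2
        rw [List.isChain_cons] at this
        exact this.1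
    subst ht
    exact ⟨c, by simp⟩
  · have := key _ hl (by simpa using hk) a ha hz'
    simp at this

theorem cyc_red (n : ℕ) : ∀ l : List (Σ i, G i), l.length = n → Red l → pr l ≠ 1 →
    ∃ u : CoprodI G, ∃ m, pr l = u * pr m * u⁻¹ ∧
      ((∃ i, ∃ a : G i, a ≠ 1 ∧ m = [⟨i, a⟩]) ∨ ∃ i j, CR i j m) := by
  classical
  induction n using Nat.strong_induction_on with
  | _ n ih =>
    intro l hn hl h1
    rcases l with _ | ⟨⟨i, a⟩, t⟩
    · simp at h1
    rcases List.eq_nil_or_concat t with rfl | ⟨t, ⟨j, b⟩, rfl⟩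
    · exact ⟨1, [⟨i, a⟩], by simp, Or.inl ⟨i, a, hl.1 ⟨i, a⟩ (by simp), rfl⟩⟩
    simp only [List.concat_eq_append] at *
    by_cases hij : i = j
    · subst hij
      have hat : Red (⟨i, a⟩ :: t) :=
        Red.of_append_left (l := ⟨i, a⟩ :: t) (m := [⟨i, b⟩]) (by simpa using hl)
      have ht : Red t := Red.of_append_right (l := [⟨i, a⟩]) hat
      have hex : ∃ s, s.length < n ∧ Red s ∧ pr s = CoprodI.of (b * a) * pr t := by
        by_cases hba : b * a = 1
        · refine ⟨t, by simp at hn; omega, ht, by simp [hba]⟩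
        · refine ⟨⟨i, b * a⟩ :: t, by simp at hn ⊢; omega, ⟨?_, ?_⟩, by simp⟩
          · intro x hx
            rcases List.mem_cons.1 hx with rfl | hx
            · exact hba
            · exact ht.1 x hx
          · have := hat.2
            simp only [List.isChain_cons] at this ⊢
            exact this
      obtain ⟨s, hsn, hs, hsp⟩ := hex
      have hconj : pr (⟨i, a⟩ :: (t ++ [⟨i, b⟩])) =
          (CoprodI.of b)⁻¹ * pr s * CoprodI.of b := by
        rw [hsp]; simp [mul_assoc]
      obtain ⟨u, m, hum, hm⟩ := ih s.length hsn s rfl hs (by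
        intro h; apply h1; rw [hconj, h]; group)
      refine ⟨(CoprodI.of b)⁻¹ * u, m, ?_, hm⟩
      rw [hconj, hum]; group
    · refine ⟨1, _, by simp only [one_mul, inv_one, mul_one], Or.inr ⟨i, j, hij, hl, ⟨a, by simp⟩, ⟨b, ?_⟩⟩⟩
      rw [← List.cons_append, List.getLast?_append]; simp

theorem gamma_lemma (g : CoprodI G) (hg : g ≠ 1) :
    (∃ u : CoprodI G, ∃ i, ∀ z, Commute z g → ∃ a : G i, z = u * CoprodI.of a * u⁻¹) ∨
    (∃ w : CoprodI G, (∀ n : ℤ, n ≠ 0 → w ^ n ≠ 1) ∧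
      ∀ z, Commute z g → z ∈ Subgroup.zpowers w) := by
  obtain ⟨l, hl, rfl⟩ := exists_red g
  obtain ⟨u, m, hum, hm⟩ := cyc_red _ l rfl hl hg
  have hcomm : ∀ z, Commute z (pr l) → Commute (u⁻¹ * z * u) (pr m) := by
    intro z hz
    have e : pr m = u⁻¹ * pr l * u := by rw [hum]; group
    rw [e]
    have : u⁻¹ * z * u * (u⁻¹ * pr l * u) = u⁻¹ * (z * pr l) * u := by group
    show _ = _
    rw [this, hz.eq]; group
  rcases hm with ⟨i, a, ha, rfl⟩ | ⟨i, j, hm⟩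
  · left
    refine ⟨u, i, fun z hz => ?_⟩
    obtain ⟨b, hb⟩ := letter_centralizer a ha (u⁻¹ * z * u) (by simpa using hcomm z hz)
    exact ⟨b, by rw [← hb]; group⟩
  · right
    obtain ⟨w, hw, hz⟩ := hm.centralizer
    refine ⟨u * w * u⁻¹, ?_, ?_⟩
    · intro n hn h
      rw [conj_zpow] at h
      exact hw n hn (conj_eq_one_iff.1 h)
    · intro z hzc
      obtain ⟨k, hk⟩ := Subgroup.mem_zpowers_iff.1 (hz _ (hcomm z hzc))
      refine Subgroup.mem_zpowers_iff.2 ⟨k, ?_⟩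
      rw [conj_zpow, hk]; group

end CP
end TKaux

namespace TKaux
open Monoid

section TK
variable {p q : ℕ}

def gen (p q : ℕ) (b : Bool) : TKG p q := PresentedGroup.of b

def ex (p q : ℕ) (b : Bool) : ℕ := cond b p q

def tkLift {H : Type*} [Group H] (f : Bool → H) (h : f true ^ p = f false ^ q) : TKG p q →* H :=
  PresentedGroup.toGroup (f := f)
    (rels := ({FreeGroup.of true ^ p * (FreeGroup.of false ^ q)⁻¹} : Set (FreeGroup Bool))) (by
      intro r hr
      rw [Set.mem_singleton_iff] at hr
      subst hr
      simp [h])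

theorem tkLift_gen {H : Type*} [Group H] (f : Bool → H) (h : f true ^ p = f false ^ q) (b : Bool) :
    tkLift f h (gen p q b) = f b :=
  PresentedGroup.toGroup.of (f := f)
    (rels := ({FreeGroup.of true ^ p * (FreeGroup.of false ^ q)⁻¹} : Set (FreeGroup Bool))) _

theorem tk_ext {H : Type*} [Group H] {f g : TKG p q →* H}
    (h : ∀ b, f (gen p q b) = g (gen p q b)) : f = g :=
  PresentedGroup.ext h

theorem tk_rel : gen p q true ^ p = gen p q false ^ q := by
  have : PresentedGroup.mk
    ({FreeGroup.of true ^ p * (FreeGroup.of false ^ q)⁻¹} : Set (FreeGroup Bool))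
    (FreeGroup.of true ^ p * (FreeGroup.of false ^ q)⁻¹) = 1 :=
    PresentedGroup.one_of_mem (Set.mem_singleton _)
  rw [map_mul, map_inv, map_pow, map_pow] at this
  exact mul_inv_eq_one.1 this

def cc (p q : ℕ) : TKG p q := gen p q true ^ p

theorem gen_pow (b : Bool) : gen p q b ^ ex p q b = cc p q := by
  cases b
  · exact tk_rel.symm
  · rfl

theorem cc_central : cc p q ∈ Subgroup.center (TKG p q) := by
  have h : (MulAut.conj (cc p q)).toMonoidHom = MonoidHom.id (TKG p q) := by
    apply tk_ext
    intro b
    have : Commute (cc p q) (gen p q b) := by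
      rw [← gen_pow b]; exact (Commute.refl _).pow_left _
    simp [this.eq]
  rw [Subgroup.mem_center_iff]
  intro g
  have := DFunLike.congr_fun h g
  simp at this
  rw [mul_inv_eq_iff_eq_mul] at this
  exact this.symm

theorem cc_infinite (hp : p ≠ 0) (hq : q ≠ 0) (n : ℤ) (h : cc p q ^ n = 1) : n = 0 := by
  let d : TKG p q →* Multiplicative ℤ :=
    tkLift (fun b => Multiplicative.ofAdd (cond b (q : ℤ) (p : ℤ))) (by
      rw [← ofAdd_nsmul, ← ofAdd_nsmul]; simp [mul_comm])
  have h2 := congrArg d h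
  rw [map_zpow, cc, map_pow, tkLift_gen, map_one, ← ofAdd_nsmul, ← ofAdd_zsmul] at h2
  have h3 := ofAdd_eq_one.1 h2
  simpa [hp, hq] using h3

abbrev Fac (p q : ℕ) (b : Bool) : Type := Multiplicative (ZMod (ex p q b))

def phi (p q : ℕ) : TKG p q →* CoprodI (Fac p q) :=
  tkLift (fun b => CoprodI.of (i := b) (Multiplicative.ofAdd (1 : ZMod (ex p q b)))) (by
    rw [← map_pow CoprodI.of, ← map_pow CoprodI.of, ← ofAdd_nsmul, ← ofAdd_nsmul]
    have h1 : p • (1 : ZMod (ex p q true)) = 0 := by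
      rw [nsmul_one]; exact ZMod.natCast_self p
    have h2 : q • (1 : ZMod (ex p q false)) = 0 := by
      rw [nsmul_one]; exact ZMod.natCast_self q
    rw [h1, h2]; simp)

theorem phi_gen (b : Bool) : phi p q (gen p q b) =
    CoprodI.of (i := b) (Multiplicative.ofAdd (1 : ZMod (ex p q b))) := tkLift_gen _ _ _

theorem fac_pow (b : Bool) (a : Fac p q b) :
    ∃ k : ℤ, phi p q (gen p q b ^ k) = CoprodI.of a := by
  obtain ⟨k, hk⟩ := ZMod.intCast_surjective (Multiplicative.toAdd a)
  refine ⟨k, ?_⟩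
  rw [map_zpow, phi_gen, ← map_zpow, ← ofAdd_zsmul, zsmul_one, hk]
  rfl

theorem phi_surj : Function.Surjective (phi p q) := by
  intro x
  induction x using CoprodI.induction_on with
  | one => exact ⟨1, map_one _⟩
  | of b a => obtain ⟨k, hk⟩ := fac_pow b a; exact ⟨_, hk⟩
  | mul x y hx hy =>
    obtain ⟨a, rfl⟩ := hx
    obtain ⟨b, rfl⟩ := hy
    exact ⟨a * b, map_mul _ _ _⟩

theorem phi_ker (g : TKG p q) (h : phi p q g = 1) : ∃ k : ℤ, g = cc p q ^ k := by
  let N : Subgroup (TKG p q) := Subgroup.zpowers (cc p q)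
  have : N.Normal := by
    refine ⟨fun n hn g => ?_⟩
    have hc : n ∈ Subgroup.center (TKG p q) :=
      (Subgroup.zpowers_le.2 cc_central) hn
    rw [Subgroup.mem_center_iff] at hc
    rw [hc g]; simpa using hn
  have hcN : (QuotientGroup.mk' N) (cc p q) = 1 :=
    (QuotientGroup.eq_one_iff _).2 (Subgroup.mem_zpowers _)
  let ψ : CoprodI (Fac p q) →* (TKG p q ⧸ N) := CoprodI.lift (fun b =>
    AddMonoidHom.toMultiplicativeLeft (ZMod.lift (ex p q b)
      ⟨zmultiplesHom (Additive (TKG p q ⧸ N)) (Additive.ofMul (QuotientGroup.mk' N (gen p q b))), by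
        rw [zmultiplesHom_apply, natCast_zsmul, ← ofMul_pow, ← map_pow, gen_pow, hcN]; rfl⟩))
  have hψ : ψ.comp (phi p q) = QuotientGroup.mk' N := by
    apply tk_ext
    intro b
    rw [MonoidHom.comp_apply, phi_gen, CoprodI.lift_of]
    change Additive.toMul (ZMod.lift (ex p q b) _ (1 : ZMod (ex p q b))) = _
    have h1 : (1 : ZMod (ex p q b)) = ((1 : ℤ) : ZMod (ex p q b)) := by simp
    rw [h1, ZMod.lift_coe]
    simp
  have h2 := DFunLike.congr_fun hψ g
  rw [MonoidHom.comp_apply, h, map_one] at h2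
  have h3 : g ∈ N := (QuotientGroup.eq_one_iff _).1 h2.symm
  obtain ⟨k, hk⟩ := Subgroup.mem_zpowers_iff.1 h3
  exact ⟨k, hk.symm⟩

theorem phi_eq {g h : TKG p q} (e : phi p q g = phi p q h) : ∃ k : ℤ, g = h * cc p q ^ k := by
  obtain ⟨k, hk⟩ := phi_ker (h⁻¹ * g) (by rw [map_mul, map_inv, e]; group)
  exact ⟨k, by rw [← hk]; group⟩

theorem main (hp : p ≠ 0) (hq : q ≠ 0) (g : TKG p q) (hg : g ∉ Subgroup.center (TKG p q)) :
    ∃ m : TKG p q, g ∈ Subgroup.zpowers m ∧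
      ∀ z : TKG p q, g ∈ Subgroup.zpowers z → z ∈ Subgroup.zpowers m := by
  have hcc : ∀ x : TKG p q, Commute (cc p q) x := fun x =>
    (Subgroup.mem_center_iff.1 cc_central x).symm
  have hphi : phi p q g ≠ 1 := by
    intro h
    obtain ⟨k, rfl⟩ := phi_ker g h
    exact hg (Subgroup.zpow_mem _ cc_central k)
  have hcomm : ∀ z : TKG p q, g ∈ Subgroup.zpowers z → Commute (phi p q z) (phi p q g) := by
    intro z hz
    obtain ⟨k, rfl⟩ := Subgroup.mem_zpowers_iff.1 hz
    exact ((Commute.refl z).zpow_right k).map _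
  rcases gamma_lemma (phi p q g) hphi with ⟨u, b, hu⟩ | ⟨w, hw, hz⟩
  · obtain ⟨U, rfl⟩ := phi_surj u
    have key : ∀ z : TKG p q, g ∈ Subgroup.zpowers z →
        z ∈ Subgroup.zpowers (U * gen p q b * U⁻¹) := by
      intro z hz
      obtain ⟨a, ha⟩ := hu _ (hcomm z hz)
      obtain ⟨k, hk⟩ := fac_pow b a
      rw [← hk, ← map_inv, ← map_mul, ← map_mul] at ha
      obtain ⟨n, hn⟩ := phi_eq ha
      refine Subgroup.mem_zpowers_iff.2 ⟨k + ex p q b * n, ?_⟩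
      rw [hn, conj_zpow, zpow_add, zpow_mul, zpow_natCast, gen_pow]
      have := ((hcc U⁻¹).zpow_left n).eq
      simp only [mul_assoc]
      rw [this]
    exact ⟨_, key g (Subgroup.mem_zpowers g), key⟩
  · obtain ⟨W, rfl⟩ := phi_surj w
    have key : ∀ z : TKG p q, g ∈ Subgroup.zpowers z → ∃ a b : ℤ, z = W ^ a * cc p q ^ b := by
      intro z hgz
      obtain ⟨a, ha⟩ := Subgroup.mem_zpowers_iff.1 (hz _ (hcomm z hgz))
      rw [← map_zpow] at ha
      obtain ⟨n, hn⟩ := phi_eq ha.symm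
      exact ⟨a, n, hn⟩
    have hpow : ∀ a b n : ℤ, (W ^ a * cc p q ^ b) ^ n = W ^ (a * n) * cc p q ^ (b * n) := by
      intro a b n
      rw [((((hcc W).symm).zpow_zpow a b)).mul_zpow, zpow_mul, zpow_mul]
    have hphic : phi p q (cc p q) = 1 := by
      rw [← gen_pow true, map_pow, phi_gen, ← map_pow, ← ofAdd_nsmul, nsmul_one,
        ZMod.natCast_self]
      simp
    have hinj : ∀ a b a' b' : ℤ, W ^ a * cc p q ^ b = W ^ a' * cc p q ^ b' → a = a' ∧ b = b' := by
      intro a b a' b' h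
      have h1 := congrArg (phi p q) h
      simp only [map_mul, map_zpow, hphic, one_zpow, mul_one] at h1
      have haa : a = a' := by
        by_contra hne
        exact hw (a - a') (sub_ne_zero.2 hne) (by rw [zpow_sub, h1]; group)
      subst haa
      have h2 := mul_left_cancel h
      have h3 := cc_infinite hp hq (b - b') (by rw [zpow_sub, h2]; group)
      exact ⟨rfl, by omega⟩
    obtain ⟨A, B, hAB⟩ := key g (Subgroup.mem_zpowers g)
    have hA : A ≠ 0 := by
      rintro rfl
      apply hphi
      rw [hAB]; simp [hphic]
    have hd : (Int.gcd A B : ℤ) ≠ 0 := by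
      intro h
      exact hA (Int.gcd_eq_zero_iff.1 (by exact_mod_cast h)).1
    obtain ⟨A', hA'⟩ := Int.gcd_dvd_left A B
    obtain ⟨B', hB'⟩ := Int.gcd_dvd_right A B
    refine ⟨W ^ A' * cc p q ^ B', ?_, ?_⟩
    · refine Subgroup.mem_zpowers_iff.2 ⟨(Int.gcd A B : ℤ), ?_⟩
      rw [hpow, hAB, mul_comm A', mul_comm B', ← hA', ← hB']
    · intro z hgz
      obtain ⟨a, b, rfl⟩ := key z hgz
      obtain ⟨n, hn⟩ := Subgroup.mem_zpowers_iff.1 hgz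
      rw [hpow, hAB] at hn
      obtain ⟨h1, h2⟩ := hinj _ _ _ _ hn
      have hn0 : n ≠ 0 := by rintro rfl; simp at h1; exact hA h1.symm
      obtain ⟨e, he⟩ : n ∣ (Int.gcd A B : ℤ) :=
        Int.dvd_coe_gcd ⟨a, by rw [← h1]; ring⟩ ⟨b, by rw [← h2]; ring⟩
      refine Subgroup.mem_zpowers_iff.2 ⟨e, ?_⟩
      rw [hpow]
      have ea : A' * e = a := by
        apply mul_left_cancel₀ hn0
        calc n * (A' * e) = (n * e) * A' := by ring
          _ = n * a := by rw [← he, ← hA', ← h1]; ring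
      have eb : B' * e = b := by
        apply mul_left_cancel₀ hn0
        calc n * (B' * e) = (n * e) * B' := by ring
          _ = n * b := by rw [← he, ← hB', ← h2]; ring
      rw [ea, eb]
end TK
end TKaux




/-- For a non-central element `g` of the torus knot group `G_{p,q}`, the maximal cyclic
subgroup containing `g` is well defined: there is a cyclic subgroup containing `g` which
contains every cyclic subgroup containing `g`. -/
theorem TKG_maximal_cyclic_well_defined (p q : ℕ) (hp : 2 ≤ p) (hq : 2 ≤ q)
    (g : TKG p q) (hg : g ∉ Subgroup.center (TKG p q)) :
    ∃ M : Subgroup (TKG p q), (∃ z : TKG p q, M = Subgroup.zpowers z) ∧ g ∈ M ∧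
      ∀ z : TKG p q, g ∈ Subgroup.zpowers z → Subgroup.zpowers z ≤ M := by
  obtain ⟨m, hm, h⟩ := TKaux.main (by omega) (by omega) g hg
  exact ⟨Subgroup.zpowers m, ⟨m, rfl⟩, hm, fun z hz => Subgroup.zpowers_le.2 (h z hz)⟩
end

section
/- Let p, q ≥ 2 be integers and G_{p,q} = ⟨x, y | x^p = y^q⟩. Suppose g ∈ G_{p,q} is not central but some nonzero power of g is central (equivalently, the inner automorphism ι_g is nontrivial of finite order; equivalently, g is elliptic and non-central for the Bass–Serre action). Then the centralizer C(g) of g is infinite cyclic, and C(g) contains every cyclic subgroup of G_{p,q} containing g (i.e. C(g) is the maximal cyclic subgroup containing g). -/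
section FreeProd
open Monoid CoprodI

variable {ι : Type*} [DecidableEq ι] {G : ι → Type*} [∀ i, Group (G i)] [∀ i, DecidableEq (G i)]

def tkLen (g : CoprodI G) : ℕ := (Word.equiv g).toList.length

def tkProd (l : List (Σ i, G i)) : CoprodI G := (l.map fun s => of s.2).prod

theorem tk_len_mul {i : ι} (m : G i) (g : CoprodI G) : tkLen (of m * g) ≤ tkLen g + 1 := by
  unfold tkLen
  have h : Word.equiv (of m * g) = m • Word.equiv g := by
    apply Word.equiv.symm.injective
    rw [Equiv.symm_apply_apply]
    change _ = Word.prod (m • Word.equiv g)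
    rw [Word.smul_eq_of_smul, Word.prod_smul]
    congr 1
    exact (Word.equiv.symm_apply_apply g).symm
  rw [h]
  generalize Word.equiv g = w
  have h1 : (Word.equivPair i w).tail.toList.length ≤ w.toList.length := by
    conv_rhs => rw [← (Word.equivPair i).symm_apply_apply w, Word.equivPair_symm]
    unfold Word.rcons
    split_ifs
    · rfl
    · simp [Word.cons]
  rw [Word.smul_def]
  refine le_trans ?_ (Nat.add_le_add_right h1 1)
  unfold Word.rcons
  split_ifs
  · simp
  · simp [Word.cons]

theorem tk_len_prod (l : List (Σ i, G i)) : tkLen (tkProd l) ≤ l.length := by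
  induction l with
  | nil =>
    have : Word.equiv (1 : CoprodI G) = Word.empty := by
      apply Word.equiv.symm.injective
      rw [Equiv.symm_apply_apply]
      exact Word.prod_empty.symm
    simp [tkProd, tkLen, this, Word.empty]
  | cons a l ih =>
    have := tk_len_mul a.2 (tkProd l)
    simp only [tkProd, List.map_cons, List.prod_cons, List.length_cons] at *
    omega

theorem tk_ne_one {i j : ι} (w : NeWord G i j) : w.prod ≠ 1 := by
  intro h
  have h2 : w.toWord = Word.empty := by
    apply Word.equiv.symm.injective
    change w.toWord.prod = Word.prod Word.empty
    rw [Word.prod_empty]; exact h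
  exact w.toList_ne_nil (congrArg Word.toList h2)

theorem tk_exists (g : CoprodI G) (hg : g ≠ 1) :
    ∃ (i j : ι) (w : NeWord G i j), w.prod = g ∧ w.toList.length = tkLen g ∧
      tkProd w.toList = g := by
  have hpg : (Word.equiv g).prod = g := Word.equiv.symm_apply_apply g
  obtain ⟨i, j, w, hw⟩ := NeWord.of_word (Word.equiv g) (by
    intro h
    apply hg
    rw [← hpg, h, Word.prod_empty])
  have : w.prod = g := by
    unfold NeWord.prod
    rw [hw, hpg]
  refine ⟨i, j, w, this, ?_, this⟩
  unfold tkLen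
  rw [← hw]; rfl

theorem tk_malnormal (i : ι) : ∀ (n : ℕ) (k : CoprodI G) (a b : G i), tkLen k ≤ n → a ≠ 1 →
    k * of a = of b * k → ∃ c : G i, k = of c := by
  intro n
  induction n using Nat.strong_induction_on with
  | _ n ih =>
  intro k a b hn ha hk
  by_cases hk1 : k = 1
  · exact ⟨1, by simp [hk1]⟩
  obtain ⟨j, l, w, hw, hlen, hpr⟩ := tk_exists k hk1
  have hb : b ≠ 1 := by
    rintro rfl
    apply ha
    apply of_injective i
    simpa using hk
  by_cases hj : j = i
  · subst hj
    have hh := w.toList_head?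
    rcases hL : w.toList with _ | ⟨s, L⟩
    · simp [hL] at hh
    · simp only [hL, List.head?_cons, Option.some.injEq] at hh
      subst hh
      rw [hL] at hpr hlen
      have hk' : k = of w.head * tkProd L := by rw [← hpr]; simp [tkProd]
      have hl' := tk_len_prod L
      simp only [List.length_cons] at hlen
      obtain ⟨c, hc⟩ := ih (tkLen (tkProd L)) (by omega) (tkProd L) a (w.head⁻¹ * b * w.head)
        le_rfl ha (by
          rw [hk'] at hk
          simp only [map_mul, map_inv]
          rw [mul_assoc, mul_assoc, ← hk]; group)
      exact ⟨w.head * c, by rw [hk', hc, map_mul]⟩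
  by_cases hl : l = i
  · subst hl
    have hh := w.toList_getLast?
    rcases List.eq_nil_or_concat w.toList with hL | ⟨L, s, hL⟩
    · simp [hL] at hh
    · rw [hL, List.concat_eq_append] at hh hpr hlen
      simp only [List.getLast?_append, List.getLast?_singleton, Option.some_or, Option.some.injEq] at hh
      subst hh
      have hk' : k = tkProd L * of w.last := by rw [← hpr]; simp [tkProd]
      have hl' := tk_len_prod L
      simp only [List.length_append, List.length_singleton] at hlen
      obtain ⟨c, hc⟩ := ih (tkLen (tkProd L)) (by omega) (tkProd L) (w.last * a * w.last⁻¹) b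
        le_rfl (by simpa using ha) (by
          rw [hk'] at hk
          simp only [map_mul, map_inv]
          rw [← mul_assoc, ← mul_assoc, hk]; group)
      exact ⟨c * w.last, by rw [hk', hc, map_mul]⟩
  exfalso
  have hb' : b⁻¹ ≠ 1 := by simpa using hb
  let W := (((w.append hl (NeWord.singleton a ha)).append (Ne.symm hl) w.inv).append hj
    (NeWord.singleton b⁻¹ hb'))
  apply tk_ne_one W
  simp only [W, NeWord.append_prod, NeWord.prod_singleton, NeWord.inv_prod, hw, map_inv]
  rw [hk]; group

theorem tk_pow {i j : ι} (hij : j ≠ i) (w : NeWord G i j) (n : ℕ) :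
    ∃ w' : NeWord G i j, w'.prod = w.prod ^ (n + 1) := by
  induction n with
  | zero => exact ⟨w, by simp⟩
  | succ n ih =>
    obtain ⟨w', h⟩ := ih
    exact ⟨w'.append hij w, by rw [NeWord.append_prod, h, ← pow_succ]⟩

theorem tk_torsion : ∀ (n : ℕ) (g : CoprodI G), tkLen g ≤ n → g ≠ 1 → IsOfFinOrder g →
    ∃ (h : CoprodI G) (i : ι) (a : G i), g = h * of a * h⁻¹ := by
  intro n
  induction n using Nat.strong_induction_on with
  | _ n ih =>
  intro g hn hg hfin
  obtain ⟨i, j, w, hw, hlen, hpr⟩ := tk_exists g hg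
  by_cases hij : j = i
  · subst hij
    have hh := w.toList_head?
    have hh2 := w.toList_getLast?
    rcases hL : w.toList with _ | ⟨s, L⟩
    · simp [hL] at hh
    simp only [hL, List.head?_cons, Option.some.injEq] at hh
    subst hh
    rw [hL] at hpr hlen hh2
    have hg' : g = of w.head * tkProd L := by rw [← hpr]; simp [tkProd]
    rcases List.eq_nil_or_concat L with rfl | ⟨M, s, rfl⟩
    · exact ⟨1, j, w.head, by simp [hg', tkProd]⟩
    · simp only [List.concat_eq_append] at *
      rw [← List.cons_append, List.getLast?_append] at hh2
      simp only [List.getLast?_singleton, Option.some_or, Option.some.injEq] at hh2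
      subst hh2
      let N : List (Σ i, G i) := M ++ [⟨j, w.last * w.head⟩]
      have hN : g = of w.head * tkProd N * (of w.head)⁻¹ := by
        rw [hg']; simp [tkProd, N, mul_assoc]
      have hl' := tk_len_prod N
      have hNl : N.length = M.length + 1 := by simp [N]
      simp only [List.length_cons, List.length_append, List.length_nil] at hlen
      have hconj : tkProd N = (of w.head)⁻¹ * g * of w.head := by rw [hN]; group
      obtain ⟨h, i, a, e⟩ := ih (tkLen (tkProd N)) (by omega) (tkProd N) le_rfl
        (by intro h1; apply hg; rw [hN, h1]; group)
        (by
          rw [isOfFinOrder_iff_pow_eq_one] at hfin ⊢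
          obtain ⟨m, hm, e⟩ := hfin
          refine ⟨m, hm, ?_⟩
          have := conj_pow (i := m) (a := (of w.head)⁻¹) (b := g)
          rw [inv_inv] at this
          rw [hconj, this, e]; group)
      exact ⟨of w.head * h, i, a, by rw [hN, e]; group⟩
  · exfalso
    rw [isOfFinOrder_iff_pow_eq_one] at hfin
    obtain ⟨m, hm, e⟩ := hfin
    obtain ⟨w', hw'⟩ := tk_pow hij w (m - 1)
    apply tk_ne_one w'
    rw [hw', hw, Nat.sub_add_cancel hm, e]

theorem tk_center {i j : ι} (hij : i ≠ j) (a : G i) (b : G j) (ha : a ≠ 1) (hb : b ≠ 1)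
    (k : CoprodI G) (hka : k * of a = of a * k) (hkb : k * of b = of b * k) : k = 1 := by
  obtain ⟨c, hc⟩ := tk_malnormal i _ k a a le_rfl ha hka
  obtain ⟨d, hd⟩ := tk_malnormal j _ k b b le_rfl hb hkb
  by_contra hk
  have hc1 : c ≠ 1 := by rintro rfl; simp [hc] at hk
  have hd1 : d⁻¹ ≠ 1 := by
    intro h; rw [inv_eq_one] at h; subst h; simp [hd] at hk
  apply tk_ne_one ((NeWord.singleton c hc1).append hij (NeWord.singleton d⁻¹ hd1))
  simp only [NeWord.append_prod, NeWord.prod_singleton, map_inv]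
  rw [← hc, ← hd]; group

end FreeProd

section TK
open Monoid

variable (p q : ℕ)

def tkN (b : Bool) : ℤ := bif b then p else q

def tkF (b : Bool) : Type := Multiplicative ℤ ⧸ Subgroup.zpowers (Multiplicative.ofAdd (tkN p q b))

instance (b : Bool) : Group (tkF p q b) := by delta tkF; infer_instance

noncomputable instance (b : Bool) : DecidableEq (tkF p q b) := Classical.decEq _

def tkU (b : Bool) : tkF p q b := QuotientGroup.mk (Multiplicative.ofAdd 1)

theorem tkU_zpow (b : Bool) (n : ℤ) :
    tkU p q b ^ n = QuotientGroup.mk (Multiplicative.ofAdd n) := by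
  have : Multiplicative.ofAdd n = (Multiplicative.ofAdd (1:ℤ)) ^ n := by
    rw [← ofAdd_zsmul]; simp
  rw [this]; rfl

theorem tkU_surj (b : Bool) (a : tkF p q b) : ∃ n : ℤ, a = tkU p q b ^ n := by
  obtain ⟨n, rfl⟩ := QuotientGroup.mk_surjective a
  exact ⟨n.toAdd, (tkU_zpow p q b _).symm⟩

theorem tkU_zpow_eq (b : Bool) (n : ℤ) : tkU p q b ^ n = 1 ↔ tkN p q b ∣ n := by
  rw [tkU_zpow]
  refine (QuotientGroup.eq_one_iff _).trans ?_
  rw [Subgroup.mem_zpowers_iff]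
  constructor
  · rintro ⟨k, hk⟩
    rw [← ofAdd_zsmul] at hk
    exact ⟨k, by have := Multiplicative.ofAdd.injective hk; rw [← this, smul_eq_mul, mul_comm]⟩
  · rintro ⟨k, rfl⟩
    exact ⟨k, by rw [← ofAdd_zsmul, smul_eq_mul, mul_comm]⟩

def tkGen (b : Bool) : TKG p q := PresentedGroup.of b

def tkC : TKG p q := tkGen p q true ^ p

theorem tkGen_pow (b : Bool) : tkGen p q b ^ (tkN p q b) = tkC p q := by
  cases b
  · have h : (PresentedGroup.mk ({FreeGroup.of true ^ p * (FreeGroup.of false ^ q)⁻¹} :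
      Set (FreeGroup Bool))) (FreeGroup.of true ^ p * (FreeGroup.of false ^ q)⁻¹) = 1 :=
      PresentedGroup.one_of_mem (by simp)
    rw [map_mul, map_inv, mul_inv_eq_one, map_pow, map_pow] at h
    simp only [tkN, cond_false, zpow_natCast]
    exact h.symm
  · simp [tkN, tkC]

/-- Universal property of the torus knot group. -/
def tkLift {K : Type*} [Group K] (f : Bool → K) (h : f true ^ p = f false ^ q) : TKG p q →* K :=
  PresentedGroup.toGroup (f := f) (rels := {FreeGroup.of true ^ p * (FreeGroup.of false ^ q)⁻¹})
    (by intro r hr; rw [Set.mem_singleton_iff] at hr; subst hr; simp [h])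

theorem tkLift_gen {K : Type*} [Group K] (f : Bool → K) (h : f true ^ p = f false ^ q) (b : Bool) :
    tkLift p q f h (tkGen p q b) = f b := PresentedGroup.toGroup.of _

theorem tk_ext {K : Type*} [Group K] (f g : TKG p q →* K)
    (h : ∀ b, f (tkGen p q b) = g (tkGen p q b)) : f = g :=
  PresentedGroup.ext h

theorem tk_closure : Subgroup.closure (Set.range (tkGen p q)) = ⊤ :=
  PresentedGroup.closure_range_of _

theorem tkC_central : tkC p q ∈ Subgroup.center (TKG p q) := by
  rw [← Subgroup.centralizer_univ, ← Subgroup.coe_top, ← tk_closure,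
    Subgroup.centralizer_closure, Subgroup.mem_centralizer_iff]
  rintro _ ⟨b, rfl⟩
  rw [← tkGen_pow p q b]
  exact (Commute.refl (tkGen p q b)).zpow_right _

instance tkC_normal : (Subgroup.zpowers (tkC p q)).Normal := by
  constructor
  intro n hn g
  have : n ∈ Subgroup.center (TKG p q) :=
    (Subgroup.zpowers_le.mpr (tkC_central p q)) hn
  rw [Subgroup.mem_center_iff] at this
  rw [this g]; simpa using hn

/-- The projection to the free product of the two finite cyclic groups. -/
def tkPi : TKG p q →* CoprodI (tkF p q) :=
  tkLift p q (fun b => CoprodI.of (tkU p q b)) (by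
    have h1 := (tkU_zpow_eq p q true p).2 (by simp [tkN])
    have h2 := (tkU_zpow_eq p q false q).2 (by simp [tkN])
    rw [zpow_natCast] at h1 h2
    simp only [← map_pow, h1, h2, map_one])

theorem tkPi_gen (b : Bool) : tkPi p q (tkGen p q b) = CoprodI.of (tkU p q b) := tkLift_gen ..

theorem tkPi_surj : Function.Surjective (tkPi p q) := by
  intro k
  induction k using CoprodI.induction_on with
  | one => exact ⟨1, map_one _⟩
  | of i m =>
    obtain ⟨n, rfl⟩ := tkU_surj p q i m
    exact ⟨tkGen p q i ^ n, by rw [map_zpow, tkPi_gen, map_zpow]⟩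
  | mul x y hx hy =>
    obtain ⟨a, rfl⟩ := hx
    obtain ⟨b, rfl⟩ := hy
    exact ⟨a * b, map_mul _ _ _⟩

def tkPsi : CoprodI (tkF p q) →* TKG p q ⧸ Subgroup.zpowers (tkC p q) :=
  CoprodI.lift fun b => QuotientGroup.lift _
    (zpowersHom _ (QuotientGroup.mk (tkGen p q b) : TKG p q ⧸ Subgroup.zpowers (tkC p q)))
    (by
      intro x hx
      obtain ⟨k, rfl⟩ := Subgroup.mem_zpowers_iff.1 hx
      rw [MonoidHom.mem_ker, map_zpow, zpowersHom_apply, toAdd_ofAdd, ← QuotientGroup.mk_zpow, tkGen_pow,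
        (QuotientGroup.eq_one_iff _).2 (Subgroup.mem_zpowers _), one_zpow])

theorem tkPsi_pi (g : TKG p q) : tkPsi p q (tkPi p q g) = QuotientGroup.mk g := by
  have : (tkPsi p q).comp (tkPi p q) = QuotientGroup.mk' (Subgroup.zpowers (tkC p q)) := by
    apply tk_ext
    intro b
    rw [MonoidHom.comp_apply, tkPi_gen]
    refine (CoprodI.lift_of _ _).trans ?_
    change (QuotientGroup.mk (tkGen p q b) : TKG p q ⧸ Subgroup.zpowers (tkC p q)) ^ (1 : ℤ) = _
    exact zpow_one _
  exact DFunLike.congr_fun this g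

theorem tkPi_ker (g : TKG p q) (h : tkPi p q g = 1) : g ∈ Subgroup.zpowers (tkC p q) := by
  rw [← QuotientGroup.eq_one_iff, ← tkPsi_pi, h, map_one]

theorem tkGen_inf (hp : 2 ≤ p) (hq : 2 ≤ q) (b : Bool) : ¬ IsOfFinOrder (tkGen p q b) := by
  intro h
  let f : TKG p q →* Multiplicative ℤ := tkLift p q
    (fun b => Multiplicative.ofAdd (bif b then (q : ℤ) else p)) (by
      simp only [cond_true, cond_false, ← ofAdd_nsmul, nsmul_eq_mul, mul_comm])
  have h2 := f.isOfFinOrder h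
  rw [isOfFinOrder_iff_pow_eq_one] at h2
  obtain ⟨n, hn, e⟩ := h2
  rw [tkLift_gen, ← ofAdd_nsmul, ofAdd_eq_one] at e
  cases b <;> simp at e <;> omega

/-- An element which projects into a factor is a power of the generator. -/
theorem tk_mem_gen (b : Bool) (k : TKG p q) (a : tkF p q b) (h : tkPi p q k = CoprodI.of a) :
    k ∈ Subgroup.zpowers (tkGen p q b) := by
  obtain ⟨n, rfl⟩ := tkU_surj p q b a
  have h1 : k * (tkGen p q b ^ n)⁻¹ ∈ Subgroup.zpowers (tkC p q) := by
    apply tkPi_ker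
    rw [map_mul, map_inv, map_zpow, tkPi_gen, h, map_zpow, mul_inv_cancel]
  have h2 : Subgroup.zpowers (tkC p q) ≤ Subgroup.zpowers (tkGen p q b) := by
    rw [Subgroup.zpowers_le, ← tkGen_pow p q b]
    exact Subgroup.zpow_mem_zpowers _ _
  have := mul_mem (h2 h1) (Subgroup.zpow_mem_zpowers (tkGen p q b) n)
  simpa using this

end TK

/-- If `g ∈ G_{p,q}` is non-central but some nonzero power of `g` is central (i.e. `g` is
elliptic and non-central), then the centralizer `C(g)` is infinite cyclic and contains
every cyclic subgroup containing `g` (it is the maximal cyclic subgroup containing `g`). -/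
theorem TKG_elliptic_centralizer (p q : ℕ) (hp : 2 ≤ p) (hq : 2 ≤ q)
    (g : TKG p q) (hg : g ∉ Subgroup.center (TKG p q))
    (hell : ∃ n : ℤ, n ≠ 0 ∧ g ^ n ∈ Subgroup.center (TKG p q)) :
    (∃ z : TKG p q, ¬ IsOfFinOrder z ∧
        Subgroup.centralizer {g} = Subgroup.zpowers z) ∧
    ∀ z : TKG p q, g ∈ Subgroup.zpowers z →
        Subgroup.zpowers z ≤ Subgroup.centralizer {g} := by
  constructor
  · have hU : ∀ b, tkU p q b ≠ 1 := by
      intro b hb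
      have h1 := (tkU_zpow_eq p q b 1).1 (by simpa using hb)
      have h2 := Int.le_of_dvd one_pos h1
      cases b <;> simp [tkN] at h2 <;> omega
    have hg1 : tkPi p q g ≠ 1 := fun h =>
      hg ((Subgroup.zpowers_le.mpr (tkC_central p q)) (tkPi_ker p q g h))
    have hfin : IsOfFinOrder (tkPi p q g) := by
      obtain ⟨n, hn, hc⟩ := hell
      rw [isOfFinOrder_iff_zpow_eq_one]
      refine ⟨n, hn, ?_⟩
      rw [Subgroup.mem_center_iff] at hc
      have hcom : ∀ b, tkPi p q g ^ n * Monoid.CoprodI.of (tkU p q b) =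
          Monoid.CoprodI.of (tkU p q b) * tkPi p q g ^ n := by
        intro b
        rw [← tkPi_gen, ← map_zpow, ← map_mul, ← map_mul, hc]
      exact tk_center (i := true) (j := false) (by simp) _ _ (hU _) (hU _) _ (hcom _) (hcom _)
    obtain ⟨h, b, a, e⟩ := tk_torsion _ (tkPi p q g) le_rfl hg1 hfin
    obtain ⟨h, rfl⟩ := tkPi_surj p q h
    have ha : a ≠ 1 := by rintro rfl; apply hg1; rw [e]; simp
    have hg' : h⁻¹ * g * h ∈ Subgroup.zpowers (tkGen p q b) := by
      apply tk_mem_gen p q b _ a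
      rw [map_mul, map_mul, map_inv, e]; group
    obtain ⟨m, hm⟩ := Subgroup.mem_zpowers_iff.1 hg'
    have hgm : g = (h * tkGen p q b * h⁻¹) ^ m := by
      rw [conj_zpow, hm]; group
    refine ⟨h * tkGen p q b * h⁻¹, ?_, ?_⟩
    · intro hf
      apply tkGen_inf p q hp hq b
      have := (MulAut.conj h⁻¹).toMonoidHom.isOfFinOrder hf
      simpa [MulAut.conj_apply, mul_assoc] using this
    · apply le_antisymm
      · intro k hk
        rw [Subgroup.mem_centralizer_singleton_iff] at hk
        have h1 : tkPi p q (h⁻¹ * k * h) * Monoid.CoprodI.of a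
            = Monoid.CoprodI.of a * tkPi p q (h⁻¹ * k * h) := by
          have e' : Monoid.CoprodI.of a = tkPi p q (h⁻¹ * g * h) := by
            rw [map_mul, map_mul, map_inv, e]; group
          rw [e', ← map_mul, ← map_mul]
          congr 1
          calc h⁻¹ * k * h * (h⁻¹ * g * h) = h⁻¹ * (k * g) * h := by group
            _ = h⁻¹ * (g * k) * h := by rw [hk]
            _ = _ := by group
        obtain ⟨c, hc⟩ := tk_malnormal b _ _ a a le_rfl ha h1
        obtain ⟨n, hn⟩ := Subgroup.mem_zpowers_iff.1 (tk_mem_gen p q b _ c hc)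
        rw [Subgroup.mem_zpowers_iff]
        refine ⟨n, ?_⟩
        rw [conj_zpow, hn]; group
      · rw [Subgroup.zpowers_le, Subgroup.mem_centralizer_singleton_iff]
        conv_lhs => rw [hgm]
        conv_rhs => rw [hgm]
        exact ((Commute.refl (h * tkGen p q b * h⁻¹)).zpow_right m)
  · intro z hz
    obtain ⟨m, rfl⟩ := Subgroup.mem_zpowers_iff.1 hz
    rw [Subgroup.zpowers_le, Subgroup.mem_centralizer_singleton_iff]
    exact (Commute.refl z).zpow_right m
end

section
/- Let p, q ≥ 2 be integers, G_{p,q} = ⟨x, y | x^p = y^q⟩, and let τ be the automorphism of G_{p,q} with τ(x) = x⁻¹ and τ(y) = y⁻¹. For g ∈ G_{p,q}, write τ_g = ι_g ∘ τ. The following are equivalent: (1) g·τ(g) = 1; (2) g·τ(g) ∈ Z(G_{p,q}); (3) τ_g has order 2 (τ_g² = id and τ_g ≠ id, or simply τ_g² = id); (4) τ_g has finite order in Aut(G_{p,q}). -/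
namespace TKGAux

open Monoid Monoid.CoprodI

section FreeProd
variable {ι : Type*} {G : ι → Type*} [∀ i, Group (G i)]

theorem neWord_pow {i j : ι} (hij : i ≠ j) (w : NeWord G i j) (n : ℕ) :
    ∃ w' : NeWord G i j, w'.prod = w.prod ^ (n + 1) := by
  induction n with
  | zero => exact ⟨w, by simp⟩
  | succ n ih =>
    obtain ⟨w', hw'⟩ := ih
    exact ⟨NeWord.append w' hij.symm w, by rw [NeWord.append_prod, hw', ← pow_succ]⟩

theorem neWord_not_central [DecidableEq ι] [∀ i, DecidableEq (G i)] [∀ i, Nontrivial (G i)]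
    {i j : ι} (hij : i ≠ j) (w : NeWord G i j)
    (hc : w.prod ∈ Subgroup.center (CoprodI G)) : False := by
  obtain ⟨m, hm⟩ := exists_ne (1 : G i)
  let s : NeWord G i i := NeWord.singleton m hm
  let u : NeWord G i i := NeWord.append (NeWord.append w hij.symm s) hij w.inv
  have h1 : u.prod = s.prod := by
    simp only [u, NeWord.append_prod, NeWord.inv_prod]
    rw [← Subgroup.mem_center_iff.1 hc, mul_inv_cancel_right]
  have h2 : u.toWord = s.toWord := by
    apply (Word.equiv (M := G)).symm.injective
    exact h1
  have h3 : u.toList.length = s.toList.length := congrArg (fun w => w.toList.length) h2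
  have h4 := List.length_pos_of_ne_nil w.toList_ne_nil
  have h5 := List.length_pos_of_ne_nil w.inv.toList_ne_nil
  simp [u, s, NeWord.toList] at h3
  omega

theorem conj_cases_word [DecidableEq ι] [∀ i, DecidableEq (G i)] (n : ℕ) :
    ∀ w : Word G, w.toList.length = n → w.prod ≠ 1 →
    ∃ c : CoprodI G, (∃ (i : ι) (m : G i), c * w.prod * c⁻¹ = CoprodI.of m) ∨
      ∃ (i j : ι) (_ : i ≠ j) (u : NeWord G i j), c * w.prod * c⁻¹ = u.prod := by
  induction n using Nat.strong_induction_on with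
  | _ n ih =>
  intro w hn h1
  induction w using Word.consRecOn with
  | empty => simp at h1
  | cons i m w' hmw hm _ =>
  rcases List.eq_nil_or_concat w'.toList with h | ⟨l, ⟨j, m'⟩, h⟩
  · have : w' = Word.empty := by ext1; exact h
    subst this
    exact ⟨1, Or.inl ⟨i, m, by simp [Word.prod_cons]⟩⟩
  · by_cases hij : i = j
    · subst hij
      let v : Word G :=
        { toList := l
          ne_one := fun x hx => w'.ne_one x (by simp [h, hx])
          chain_ne := by
            have := w'.chain_ne
            rw [h] at this
            simp [List.isChain_append] at this
            exact this.1 }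
      have hv : w'.prod = v.prod * CoprodI.of m' := by
        simp [Word.prod, h, v]
      have hl : l ≠ [] := by
        rintro rfl
        apply hmw
        simp [Word.fstIdx, h]
      have hvi : v.fstIdx ≠ some i := by
        intro hvi
        apply hmw
        rw [← hvi]
        cases l with
        | nil => exact absurd rfl hl
        | cons a l => simp [Word.fstIdx, h, v]
      have hlen : n = l.length + 2 := by
        rw [← hn]; simp [Word.cons, h]
      have hconj : CoprodI.of m' * (Word.cons m w' hmw hm).prod * (CoprodI.of m')⁻¹
          = CoprodI.of (m' * m) * v.prod := by
        rw [Word.prod_cons, hv]; simp [mul_assoc]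
      have key : ∀ v' : Word G, v'.toList.length < n → v'.prod = CoprodI.of (m' * m) * v.prod →
          ∃ c : CoprodI G, (∃ (k : ι) (m₁ : G k),
            c * (Word.cons m w' hmw hm).prod * c⁻¹ = CoprodI.of m₁) ∨
            ∃ (i j : ι) (_ : i ≠ j) (u : NeWord G i j),
              c * (Word.cons m w' hmw hm).prod * c⁻¹ = u.prod := by
        intro v' hv' he
        rw [← hconj] at he
        obtain ⟨c, hc⟩ := ih _ hv' v' rfl (by
          rw [he]; intro h0; apply h1
          exact conj_eq_one_iff.1 h0)
        refine ⟨c * CoprodI.of m', ?_⟩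
        have e : c * CoprodI.of m' * (Word.cons m w' hmw hm).prod * (c * CoprodI.of m')⁻¹
          = c * v'.prod * c⁻¹ := by rw [he]; group
        rw [e]; exact hc
      by_cases hmm : m' * m = 1
      · exact key v (by simp [v, hlen]) (by simp [hmm])
      · exact key (Word.cons (m' * m) v hvi hmm) (by simp [v, hlen, Word.cons])
          (by rw [Word.prod_cons])
    · refine ⟨1, Or.inr ?_⟩
      obtain ⟨i', j', u, hu⟩ := NeWord.of_word (Word.cons m w' hmw hm) (by
        intro h0; apply h1; rw [h0]; simp)
      have hh := u.toList_head?
      have hl := u.toList_getLast?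
      have hul : u.toList = ⟨i, m⟩ :: w'.toList := by
        have := congrArg Word.toList hu
        exact this
      rw [hul] at hh hl
      rw [h] at hl
      simp at hh
      have e2 : (⟨i, m⟩ :: l.concat ⟨j, m'⟩ : List (Σ i, G i)).getLast? = some ⟨j, m'⟩ := by
        rw [List.concat_eq_append, ← List.cons_append, List.getLast?_concat]
      rw [e2] at hl
      have hi : i = i' := hh.1
      have hj : j = j' := by
        have := Option.some.inj hl
        exact congrArg Sigma.fst this
      subst hi hj
      exact ⟨i, j, hij, u, by rw [NeWord.prod, hu]; simp⟩

theorem conj_of_pow_central [DecidableEq ι] [∀ i, DecidableEq (G i)] [∀ i, Nontrivial (G i)]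
    [Nonempty ι] (g : CoprodI G) (n : ℕ) (hc : g ^ (n + 1) ∈ Subgroup.center (CoprodI G)) :
    ∃ (c : CoprodI G) (i : ι) (m : G i), g = c * CoprodI.of m * c⁻¹ := by
  by_cases hg : g = 1
  · exact ⟨1, Classical.arbitrary ι, 1, by simp [hg]⟩
  have hw : (Word.equiv (M := G) g).prod = g := (Word.equiv (M := G)).symm_apply_apply g
  obtain ⟨c, ⟨i, m, h⟩ | ⟨i, j, hij, u, h⟩⟩ :=
    conj_cases_word _ (Word.equiv (M := G) g) rfl (by rwa [hw])
  · rw [hw] at h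
    exact ⟨c⁻¹, i, m, by rw [← h]; group⟩
  · exfalso
    rw [hw] at h
    obtain ⟨w', hw'⟩ := neWord_pow hij u n
    apply neWord_not_central hij w'
    rw [hw', ← h, conj_pow]
    exact Subgroup.Normal.conj_mem inferInstance _ hc c

end FreeProd

section TK
variable (p q : ℕ)

/-- Order of the b-th factor. -/
abbrev N (b : Bool) : ℕ := bif b then p else q

/-- The cyclic factors. -/
abbrev C (b : Bool) : Type := Multiplicative (ZMod (N p q b))

/-- Generators. -/
def gen (b : Bool) : TKG p q := PresentedGroup.of b

/-- Homs out of the torus knot group. -/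
def homOf {H : Type*} [Group H] (f : Bool → H) (hf : f true ^ p = f false ^ q) :
    TKG p q →* H :=
  PresentedGroup.toGroup (f := f) (by
    intro r hr
    rw [Set.mem_singleton_iff] at hr
    subst hr
    simp [hf])

theorem homOf_gen {H : Type*} [Group H] (f : Bool → H) (hf : f true ^ p = f false ^ q) (b : Bool) :
    homOf p q f hf (gen p q b) = f b :=
  PresentedGroup.toGroup.of _

theorem hom_ext {H : Type*} [Group H] (f g : TKG p q →* H)
    (h : ∀ b, f (gen p q b) = g (gen p q b)) : f = g :=
  PresentedGroup.ext h

theorem closure_gen : Subgroup.closure (Set.range (gen p q)) = ⊤ :=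
  PresentedGroup.closure_range_of _

theorem rel : gen p q true ^ p = gen p q false ^ q := by
  have h : (PresentedGroup.mk ({FreeGroup.of true ^ p * (FreeGroup.of false ^ q)⁻¹} :
      Set (FreeGroup Bool))) (FreeGroup.of true ^ p * (FreeGroup.of false ^ q)⁻¹) = 1 :=
    PresentedGroup.one_of_mem rfl
  rw [map_mul, map_inv, map_pow, map_pow, mul_inv_eq_one] at h
  exact h

/-- The central element. -/
def z : TKG p q := gen p q true ^ p

theorem gen_pow (b : Bool) : gen p q b ^ N p q b = z p q := by
  cases b
  · exact (rel p q).symm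
  · rfl

theorem z_central : z p q ∈ Subgroup.center (TKG p q) := by
  have : (⊤ : Subgroup (TKG p q)) ≤ Subgroup.centralizer {z p q} := by
    rw [← closure_gen, Subgroup.closure_le]
    rintro _ ⟨b, rfl⟩
    rw [SetLike.mem_coe, Subgroup.mem_centralizer_singleton_iff, ← gen_pow p q b]
    exact (Commute.self_pow _ _).eq
  rw [Subgroup.mem_center_iff]
  intro g
  exact Subgroup.mem_centralizer_singleton_iff.1 (this (Subgroup.mem_top g))

/-- The quotient map onto the free product. -/
def proj : TKG p q →* CoprodI (C p q) :=
  homOf p q (fun b => CoprodI.of (M := C p q) (i := b) (Multiplicative.ofAdd 1)) (by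
    rw [← map_pow (CoprodI.of (M := C p q) (i := true)),
      ← map_pow (CoprodI.of (M := C p q) (i := false)), ← ofAdd_nsmul, ← ofAdd_nsmul]
    have h1 : (p • (1 : ZMod (N p q true))) = 0 := by simp [N]
    have h2 : (q • (1 : ZMod (N p q false))) = 0 := by simp [N]
    rw [h1, h2, ofAdd_zero, ofAdd_zero, map_one, map_one])

theorem exists_zpow (b : Bool) (m : C p q b) :
    ∃ k : ℤ, CoprodI.of m = proj p q (gen p q b ^ k) := by
  obtain ⟨k, hk⟩ := ZMod.intCast_surjective (Multiplicative.toAdd m)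
  refine ⟨k, ?_⟩
  rw [map_zpow, proj, homOf_gen, ← map_zpow, ← ofAdd_zsmul]
  congr 1
  apply Multiplicative.toAdd.injective
  rw [← hk]; simp

theorem proj_surj : Function.Surjective (proj p q) := by
  intro g
  induction g using CoprodI.induction_on with
  | one => exact ⟨1, map_one _⟩
  | of b m => obtain ⟨k, hk⟩ := exists_zpow p q b m; exact ⟨_, hk.symm⟩
  | mul a b ha hb =>
    obtain ⟨a, rfl⟩ := ha
    obtain ⟨b, rfl⟩ := hb
    exact ⟨a * b, map_mul _ _ _⟩

theorem ker_proj (h : TKG p q) (hh : proj p q h = 1) : ∃ k : ℤ, h = z p q ^ k := by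
  let Z := Subgroup.zpowers (z p q)
  have hZ : Z.Normal := by
    constructor
    intro a ha g
    obtain ⟨k, rfl⟩ := ha
    have := Subgroup.mem_center_iff.1 (Subgroup.zpow_mem _ (z_central p q) k) g
    simp only [] 
    rw [this, mul_inv_cancel_right]
    exact ⟨k, rfl⟩
  let f : ∀ b, C p q b →* (TKG p q ⧸ Z) := fun b =>
    AddMonoidHom.toMultiplicativeLeft (ZMod.lift (N p q b)
      ⟨zmultiplesHom (Additive (TKG p q ⧸ Z))
        (Additive.ofMul (QuotientGroup.mk (gen p q b))), by
        rw [zmultiplesHom_apply, natCast_zsmul, ← ofMul_pow, ← QuotientGroup.mk_pow, gen_pow]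
        rw [(QuotientGroup.eq_one_iff (N := Z) _).2 (Subgroup.mem_zpowers _)]; rfl⟩)
  have hf : ∀ b, f b (Multiplicative.ofAdd 1) = QuotientGroup.mk (gen p q b) := by
    intro b
    have := ZMod.lift_coe (N p q b) (⟨zmultiplesHom (Additive (TKG p q ⧸ Z))
        (Additive.ofMul (QuotientGroup.mk (gen p q b))), by
        rw [zmultiplesHom_apply, natCast_zsmul, ← ofMul_pow, ← QuotientGroup.mk_pow, gen_pow]
        rw [(QuotientGroup.eq_one_iff (N := Z) _).2 (Subgroup.mem_zpowers _)]; rfl⟩ :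
          { f : ℤ →+ Additive (TKG p q ⧸ Z) // f (N p q b) = 0 }) 1
    rw [Int.cast_one] at this
    refine this.trans ?_
    simp
    rfl
  have e : (CoprodI.lift f).comp (proj p q) = QuotientGroup.mk' Z := by
    apply hom_ext
    intro b
    rw [MonoidHom.comp_apply, proj, homOf_gen, CoprodI.lift_of, hf]
    rfl
  have h2 : QuotientGroup.mk' Z h = 1 := by
    rw [← e, MonoidHom.comp_apply, hh, map_one]
  have h3 : h ∈ Z := (QuotientGroup.eq_one_iff (N := Z) _).1 h2
  obtain ⟨k, hk⟩ := h3
  exact ⟨k, hk.symm⟩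

/-- The degree map. -/
def deg : TKG p q →* Multiplicative ℤ :=
  homOf p q (fun b => Multiplicative.ofAdd ((N p q (!b) : ℕ) : ℤ)) (by
    rw [← ofAdd_nsmul, ← ofAdd_nsmul]
    simp [N, mul_comm])

theorem eq_one_of_pow_central (hp : 2 ≤ p) (hq : 2 ≤ q) (h : TKG p q) (n : ℕ)
    (hc : h ^ (n + 1) ∈ Subgroup.center (TKG p q)) (hd : deg p q h = 1) : h = 1 := by
  classical
  have hN : ∀ b, 2 ≤ N p q b := by rintro (_ | _) <;> assumption
  have : ∀ b, Nontrivial (C p q b) := fun b => by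
    have : Fact (1 < N p q b) := ⟨hN b⟩
    infer_instance
  obtain ⟨c, b, m, hm⟩ := conj_of_pow_central (proj p q h) n (by
    rw [Subgroup.mem_center_iff]
    intro g
    obtain ⟨g, rfl⟩ := proj_surj p q g
    rw [← map_pow, ← map_mul, ← map_mul, Subgroup.mem_center_iff.1 hc])
  obtain ⟨c, rfl⟩ := proj_surj p q c
  obtain ⟨i, hi⟩ := exists_zpow p q b m
  rw [hi, ← map_inv, ← map_mul, ← map_mul, ← mul_inv_eq_one, ← map_inv, ← map_mul] at hm
  obtain ⟨k, hk⟩ := ker_proj p q _ hm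
  rw [mul_inv_eq_iff_eq_mul] at hk
  have hg : deg p q (gen p q b) = Multiplicative.ofAdd ((N p q (!b) : ℕ) : ℤ) := homOf_gen ..
  have hdeg := congrArg (deg p q) hk
  rw [hd, ← gen_pow p q b] at hdeg
  simp only [map_mul, map_zpow, map_pow, map_inv, hg] at hdeg
  rw [mul_inv_cancel_comm] at hdeg
  have h0 := congrArg Multiplicative.toAdd hdeg
  simp only [toAdd_one, toAdd_mul, toAdd_zpow, toAdd_pow, toAdd_ofAdd, smul_eq_mul, nsmul_eq_mul] at h0
  have hpos : ((N p q (!b) : ℕ) : ℤ) ≠ 0 := by have := hN (!b); omega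
  have hik : i = N p q b * (-k) := by
    apply mul_right_cancel₀ hpos
    linarith
  rw [hk, hik, zpow_mul, zpow_natCast, gen_pow]
  rw [Subgroup.mem_center_iff.1 (Subgroup.zpow_mem _ (z_central p q) (-k)) c, 
    mul_inv_cancel_right, ← zpow_add]
  simp

end TK
end TKGAux

/-- For `τ_g = ι_g ∘ τ`, where `τ : x ↦ x⁻¹, y ↦ y⁻¹`, the following are equivalent:
`g·τ(g) = 1`; `g·τ(g)` is central; `τ_g` has order dividing `2`; `τ_g` has finite order. -/
theorem TKG_tau_g_finite_order_characterisation (p q : ℕ) (hp : 2 ≤ p) (hq : 2 ≤ q)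
    (τ : MulAut (TKG p q))
    (hτx : τ (TKx p q) = (TKx p q)⁻¹) (hτy : τ (TKy p q) = (TKy p q)⁻¹)
    (g : TKG p q) :
    (g * τ g = 1 ↔ g * τ g ∈ Subgroup.center (TKG p q)) ∧
    (g * τ g ∈ Subgroup.center (TKG p q) ↔ (MulAut.conj g * τ) ^ 2 = 1) ∧
    ((MulAut.conj g * τ) ^ 2 = 1 ↔ IsOfFinOrder (MulAut.conj g * τ)) := by
  have hgen : ∀ b, τ (TKGAux.gen p q b) = (TKGAux.gen p q b)⁻¹ := by
    rintro (_ | _)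
    · exact hτy
    · exact hτx
  have hττ : ∀ a, τ (τ a) = a := by
    have : (τ.toMonoidHom.comp τ.toMonoidHom) = MonoidHom.id _ := by
      apply TKGAux.hom_ext
      intro b
      change τ (τ _) = _
      rw [hgen, map_inv, hgen, inv_inv]; rfl
    exact fun a => DFunLike.congr_fun this a
  have hdeg : ∀ a, TKGAux.deg p q (τ a) = (TKGAux.deg p q a)⁻¹ := by
    have : (TKGAux.deg p q).comp τ.toMonoidHom = (TKGAux.deg p q)⁻¹ := by
      apply TKGAux.hom_ext
      intro b
      change TKGAux.deg p q (τ _) = (TKGAux.deg p q _)⁻¹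
      rw [hgen, map_inv]
    exact fun a => DFunLike.congr_fun this a
  have hd : TKGAux.deg p q (g * τ g) = 1 := by rw [map_mul, hdeg, mul_inv_cancel]
  have hsq : (MulAut.conj g * τ) ^ 2 = MulAut.conj (g * τ g) := by
    ext a
    simp [pow_two, hττ, mul_assoc]
  have hconj : ∀ a : TKG p q, MulAut.conj a = 1 ↔ a ∈ Subgroup.center (TKG p q) := by
    intro a
    rw [Subgroup.mem_center_iff, MulEquiv.ext_iff]
    refine forall_congr' fun b => ?_
    rw [MulAut.conj_apply, MulAut.one_apply, mul_inv_eq_iff_eq_mul, eq_comm]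
  have h41 : IsOfFinOrder (MulAut.conj g * τ) → g * τ g = 1 := by
    intro h
    obtain ⟨n, hn, h⟩ := isOfFinOrder_iff_pow_eq_one.1 h
    obtain ⟨n, rfl⟩ : ∃ m, n = m + 1 := ⟨n - 1, by omega⟩
    refine TKGAux.eq_one_of_pow_central p q hp hq _ n ?_ hd
    rw [← hconj, map_pow, ← hsq, ← pow_mul, mul_comm, pow_mul, h, one_pow]
  have h34 : (MulAut.conj g * τ) ^ 2 = 1 → IsOfFinOrder (MulAut.conj g * τ) := fun h =>
    isOfFinOrder_iff_pow_eq_one.2 ⟨2, by norm_num, h⟩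
  have h23 : g * τ g ∈ Subgroup.center (TKG p q) ↔ (MulAut.conj g * τ) ^ 2 = 1 := by
    rw [hsq, hconj]
  have h12 : g * τ g = 1 → g * τ g ∈ Subgroup.center (TKG p q) := fun h => by
    rw [h]; exact Subgroup.one_mem _
  exact ⟨⟨h12, fun h => h41 (h34 (h23.1 h))⟩, h23, h34, fun h => h23.1 (h12 (h41 h))⟩
end
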